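/- arXiv:2303.16665 — 7 statements merged into one kernel-verified Lean document; each statement's English description precedes it below -/
import Mathlib

section
/- Let Γ be a group of invertible affine transformations of ℝ³ whose linear parts all have determinant 1. Assume that Γ preserves no proper nonempty affine subspace of ℝ³ (i.e., for every affine subspace S of ℝ³ with ∅ ≠ S ≠ ℝ³ there exists γ ∈ Γ with γ(S) ≠ S). Assume moreover that every element of Γ commutes with the affine transformation φ(x) = b + g(x), where g ∈ SL(3,ℝ), b ∈ ker(g − id), and (b, g) ≠ (0, id). Then there exists a nonzero vector v ∈ ℝ³ such that for every γ ∈ Γ, the linear part f of γ satisfies f(v) = v or f(v) = −v; in other words, the line ℝv is invariant under the linear part of every element of Γ. -/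
open Matrix

section

variable {V : Type*} [AddCommGroup V] [Module ℝ V]

/-- A group of affine transformations preserving no proper nonempty affine subspace does not
even map such a subspace into itself. -/
theorem eq_top_of_forall_mapsTo (Γ : Subgroup (V ≃ᵃ[ℝ] V))
    (hirr : ∀ S : AffineSubspace ℝ V, (S : Set V) ≠ ∅ → S ≠ ⊤ →
      ∃ γ ∈ Γ, (γ : V ≃ᵃ[ℝ] V) '' (S : Set V) ≠ (S : Set V))
    (S : AffineSubspace ℝ V) (hne : (S : Set V).Nonempty)
    (hS : ∀ γ ∈ Γ, ∀ x ∈ S, (γ : V ≃ᵃ[ℝ] V) x ∈ S) : S = ⊤ := by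
  by_contra htop
  obtain ⟨γ, hγ, himage⟩ := hirr S hne.ne_empty htop
  refine himage (Set.Subset.antisymm ?_ fun x hx => ?_)
  · rintro _ ⟨x, hx, rfl⟩
    exact hS γ hγ x hx
  · exact ⟨γ⁻¹ x, hS γ⁻¹ (Γ.inv_mem hγ) x hx, γ.apply_symm_apply x⟩

/-- If `N ^ 2 = 0`, `b ∈ ker N \ im N` and `N u ≠ 0`, then `N u`, `b`, `u` are linearly
independent. -/
theorem linearIndependent_of_sq_eq_zero (N : V →ₗ[ℝ] V) (hN : ∀ x, N (N x) = 0) {b u : V}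
    (hb : N b = 0) (hbN : ∀ x, N x ≠ b) (hu : N u ≠ 0) :
    LinearIndependent ℝ ![N u, b, u] := by
  rw [Fintype.linearIndependent_iff]
  intro a ha
  have h : a 0 • N u + a 1 • b + a 2 • u = 0 := by simpa [Fin.sum_univ_three] using ha
  have h2 : a 2 = 0 := by simpa [hN, hb, hu] using congrArg N h
  have h1 : a 1 = 0 := by
    by_contra h1
    refine hbN (-(a 1)⁻¹ • a 0 • u) ?_
    have h' : a 0 • N u = -(a 1 • b) := by simpa [h2, add_eq_zero_iff_eq_neg] using h
    simp [h', h1]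
  have h0 : a 0 = 0 := by simpa [h1, h2, hu] using h
  intro i
  fin_cases i <;> assumption

/-- Let `N ^ 2 = 0`, `b ∈ ker N \ im N` and `N u ≠ 0` in a three-dimensional space.  A linear
map of determinant `1` commuting with `N` and fixing `b` modulo `im N` sends `N u` to
`± N u`. -/
theorem map_eq_or_eq_neg_of_det_eq_one (hV : Module.finrank ℝ V = 3)
    (N : V →ₗ[ℝ] V) (hN : ∀ x, N (N x) = 0) {b u : V}
    (hb : N b = 0) (hbN : ∀ x, N x ≠ b) (hu : N u ≠ 0) (f : V →ₗ[ℝ] V)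
    (hdet : LinearMap.det f = 1) (hf : ∀ x, f (N x) = N (f x)) {c : V}
    (hfb : f b = b + N c) : f (N u) = N u ∨ f (N u) = -N u := by
  let B : Module.Basis (Fin 3) ℝ V := basisOfLinearIndependentOfCardEqFinrank
    (linearIndependent_of_sq_eq_zero N hN hb hbN hu) (by simp [hV])
  have hB : ⇑B = ![N u, b, u] := coe_basisOfLinearIndependentOfCardEqFinrank _ _
  have hB0 : B 0 = N u := by simp [hB]
  have hB1 : B 1 = b := by simp [hB]
  have hB2 : B 2 = u := by simp [hB]
  have hNx (x : V) : N x = B.repr x 2 • B 0 := by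
    have h := congrArg N (B.sum_repr x)
    simp only [Fin.sum_univ_three, map_add, map_smul, hB0, hB1, hB2, hN, hb, smul_zero,
      zero_add] at h
    rw [← h, hB0]
  have hf0 : f (B 0) = B.repr (f u) 2 • B 0 := by rw [← hNx, hB0, hf]
  have hf1 : f (B 1) = B 1 + B.repr c 2 • B 0 := by rw [← hNx, hB1, hfb]
  have hsq : B.repr (f u) 2 * B.repr (f u) 2 = 1 := by
    rw [← hdet, ← LinearMap.det_toMatrix B, Matrix.det_fin_three]
    simp [LinearMap.toMatrix_apply, hf0, hf1, hB2]
  rw [← hB0, hf0]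
  rcases mul_self_eq_one_iff.mp hsq with h | h <;> simp [h]

end

/-- Let `Γ` be a group of invertible affine transformations of `ℝ³` whose linear parts all
have determinant `1`, preserving no proper nonempty affine subspace, and all commuting with
a nontrivial affine transformation `φ(x) = b + g x` with `g ∈ SL(3,ℝ)` and
`b ∈ ker (g - id)`.  Then there is a nonzero `v ∈ ℝ³` such that the linear part of every
element of `Γ` sends `v` to `v` or to `-v`, i.e. the line `ℝ v` is invariant under the
linear part of every element of `Γ`. -/
theorem stmt_0 (Γ : Subgroup ((Fin 3 → ℝ) ≃ᵃ[ℝ] (Fin 3 → ℝ)))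
    (hdet : ∀ γ ∈ Γ, LinearMap.det
      ((γ : (Fin 3 → ℝ) ≃ᵃ[ℝ] (Fin 3 → ℝ)).linear : (Fin 3 → ℝ) →ₗ[ℝ] (Fin 3 → ℝ)) = 1)
    (hirr : ∀ S : AffineSubspace ℝ (Fin 3 → ℝ), (S : Set (Fin 3 → ℝ)) ≠ ∅ → S ≠ ⊤ →
      ∃ γ ∈ Γ, (γ : (Fin 3 → ℝ) ≃ᵃ[ℝ] (Fin 3 → ℝ)) '' (S : Set (Fin 3 → ℝ)) ≠ (S : Set (Fin 3 → ℝ)))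
    (g : Matrix (Fin 3) (Fin 3) ℝ) (b : Fin 3 → ℝ)
    (hg : g.det = 1) (hb : g.mulVec b = b) (hnt : ¬ (b = 0 ∧ g = 1))
    (hcomm : ∀ γ ∈ Γ, ∀ x : Fin 3 → ℝ,
      (γ : (Fin 3 → ℝ) ≃ᵃ[ℝ] (Fin 3 → ℝ)) (b + g.mulVec x)
        = b + g.mulVec ((γ : (Fin 3 → ℝ) ≃ᵃ[ℝ] (Fin 3 → ℝ)) x)) :
    ∃ v : Fin 3 → ℝ, v ≠ 0 ∧ ∀ γ ∈ Γ,
      (γ : (Fin 3 → ℝ) ≃ᵃ[ℝ] (Fin 3 → ℝ)).linear v = v ∨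
      (γ : (Fin 3 → ℝ) ≃ᵃ[ℝ] (Fin 3 → ℝ)).linear v = -v := by
  set N : (Fin 3 → ℝ) →ₗ[ℝ] (Fin 3 → ℝ) := g.mulVecLin - LinearMap.id with hNdef
  have hgN (x : Fin 3 → ℝ) : g.mulVec x = x + N x := by simp [hNdef]
  have hNb : N b = 0 := by simp [hNdef, hb]
  have happ (γ : (Fin 3 → ℝ) ≃ᵃ[ℝ] (Fin 3 → ℝ)) (x : Fin 3 → ℝ) : γ x = γ.linear x + γ 0 := by
    simpa using γ.map_vadd 0 x
  have hψ : ∀ γ ∈ Γ, ∀ x, N (γ x) + b = γ.linear (N x + b) := by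
    intro γ hγ x
    have h := hcomm γ hγ x
    rw [hgN, hgN, happ γ (b + _), happ γ x] at h
    rw [happ γ x]
    simp only [map_add] at h ⊢
    linear_combination (exp := 1) -h
  have hfb : ∀ γ ∈ Γ, γ.linear b = b + N (γ 0) := by
    intro γ hγ
    simpa [add_comm] using (hψ γ hγ 0).symm
  have hfN : ∀ γ ∈ Γ, ∀ x, γ.linear (N x) = N (γ.linear x) := by
    intro γ hγ x
    have h := hψ γ hγ x
    rw [happ γ x, map_add, map_add, hfb γ hγ] at h
    linear_combination (exp := 1) -h
  have hsq (x : Fin 3 → ℝ) : N (N x) = 0 := by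
    have h := eq_top_of_forall_mapsTo Γ hirr (LinearMap.ker (N ∘ₗ N)).toAffineSubspace
      ⟨0, by simp⟩ fun γ hγ x hx => by
        have hx' : N (N x) = 0 := by simpa using hx
        have h := congrArg N (hψ γ hγ x)
        rw [← hfN γ hγ] at h
        simpa [hNb, hx'] using h
    have hx : x ∈ (LinearMap.ker (N ∘ₗ N)).toAffineSubspace := h ▸ AffineSubspace.mem_top ℝ _ x
    simpa using hx
  by_cases hN : ∀ x, N x = 0
  · refine ⟨b, fun hb0 => hnt ⟨hb0, ?_⟩, fun γ hγ => Or.inl ?_⟩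
    · exact Matrix.ext_of_mulVec_single fun i => by rw [hgN, hN, add_zero, Matrix.one_mulVec]
    · simpa [hN] using hfb γ hγ
  · push Not at hN
    obtain ⟨u, hu⟩ := hN
    have hbN (p : Fin 3 → ℝ) : N p ≠ b := by
      intro hp
      have h := eq_top_of_forall_mapsTo Γ hirr (AffineSubspace.mk' (-p) (LinearMap.ker N))
        ⟨-p, AffineSubspace.self_mem_mk' _ _⟩ fun γ hγ x hx => by
          have hx' : N x + b = 0 := by simpa [AffineSubspace.mem_mk', hp] using hx
          have h := hψ γ hγ x
          simpa [AffineSubspace.mem_mk', hp, hx'] using h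
      have hmem (x : Fin 3 → ℝ) : N x + b = 0 := by
        have hx : x ∈ AffineSubspace.mk' (-p) (LinearMap.ker N) :=
          h ▸ AffineSubspace.mem_top ℝ _ x
        simpa [AffineSubspace.mem_mk', hp] using hx
      have hb0 : b = 0 := by simpa using hmem 0
      exact hu (by simpa [hb0] using hmem u)
    exact ⟨N u, hu, fun γ hγ => map_eq_or_eq_neg_of_det_eq_one (by simp) N hsq hNb hbN hu
      γ.linear (hdet γ hγ) (hfN γ hγ) (hfb γ hγ)⟩
end

section
/- Let Γ be a group of invertible affine transformations of ℝⁿ that preserves no proper nonempty affine subspace of ℝⁿ (i.e., for every affine subspace S of ℝⁿ with ∅ ≠ S ≠ ℝⁿ there exists γ ∈ Γ with γ(S) ≠ S). Let φ(x) = b + g(x) be an affine transformation with g ∈ GL(n,ℝ), b ∈ ker(g − id), and φ ≠ id, such that φ commutes with every element of Γ. Then b ≠ 0. -/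
open Matrix

/-- Let `Γ` be a group of invertible affine transformations of `ℝⁿ` preserving no proper
nonempty affine subspace.  If the affine transformation `φ(x) = b + g x`, with
`g ∈ GL(n,ℝ)`, `b ∈ ker (g - id)` and `φ ≠ id`, commutes with every element of `Γ`,
then `b ≠ 0`. -/
theorem stmt_1 (n : ℕ) (Γ : Subgroup ((Fin n → ℝ) ≃ᵃ[ℝ] (Fin n → ℝ)))
    (hirr : ∀ S : AffineSubspace ℝ (Fin n → ℝ), (S : Set (Fin n → ℝ)) ≠ ∅ → S ≠ ⊤ →
      ∃ γ ∈ Γ, (γ : (Fin n → ℝ) ≃ᵃ[ℝ] (Fin n → ℝ)) '' (S : Set (Fin n → ℝ)) ≠ (S : Set (Fin n → ℝ)))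
    (g : Matrix (Fin n) (Fin n) ℝ) (b : Fin n → ℝ)
    (hg : IsUnit g) (hb : g.mulVec b = b)
    (hne : (fun x : Fin n → ℝ => b + g.mulVec x) ≠ id)
    (hcomm : ∀ γ ∈ Γ, ∀ x : Fin n → ℝ,
      (γ : (Fin n → ℝ) ≃ᵃ[ℝ] (Fin n → ℝ)) (b + g.mulVec x)
        = b + g.mulVec ((γ : (Fin n → ℝ) ≃ᵃ[ℝ] (Fin n → ℝ)) x)) :
    b ≠ 0 := by
  rintro rfl
  simp only [zero_add] at hne hcomm
  let S : AffineSubspace ℝ (Fin n → ℝ) := (LinearMap.eqLocus g.mulVecLin LinearMap.id).toAffineSubspace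
  have hS (x : Fin n → ℝ) : x ∈ S ↔ g.mulVec x = x := Iff.rfl
  have hmap : ∀ γ ∈ Γ, ∀ x ∈ S, γ x ∈ S := by
    intro γ hγ x hx
    rw [hS] at hx ⊢
    rw [← hcomm γ hγ, hx]
  have hnonempty : (S : Set (Fin n → ℝ)) ≠ ∅ :=
    Set.nonempty_iff_ne_empty.mp ⟨0, (hS 0).mpr (g.mulVec_zero)⟩
  have hproper : S ≠ ⊤ := by
    intro h
    refine hne (funext fun x => (hS x).mp ?_)
    rw [h]
    exact AffineSubspace.mem_top ℝ _ x
  obtain ⟨γ, hγ, hγS⟩ := hirr S hnonempty hproper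
  refine hγS (Set.Subset.antisymm ?_ fun x hx => ?_)
  · rintro _ ⟨x, hx, rfl⟩
    exact hmap γ hγ x hx
  · exact ⟨γ⁻¹ x, hmap γ⁻¹ (Γ.inv_mem hγ) x hx, γ.apply_symm_apply x⟩
end

section
/- Let g₃ be the 3×3 real matrix with rows (1,0,1), (0,1,0), (0,0,1), and let φ be the affine transformation of ℝ³ given by φ(x) = e₁ + g₃(x). Let γ(x) = c + f(x) be an affine transformation of ℝ³ with f a 3×3 real matrix of determinant 1, and suppose γ commutes with φ. Then c₃ = f₁₁ − 1, and γ maps the affine plane {x ∈ ℝ³ : x₃ = −1} into itself. -/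
open Matrix

/-- Let `φ(x) = e₁ + g₃ x` with `g₃ = !![1,0,1; 0,1,0; 0,0,1]`, and let `γ(x) = c + f x`
be an affine transformation of `ℝ³` with `det f = 1` commuting with `φ`.  Then
`c₃ = f₁₁ - 1` and `γ` maps the affine plane `{x : x₃ = -1}` into itself. -/
theorem stmt_12 (f : Matrix (Fin 3) (Fin 3) ℝ) (hdet : f.det = 1) (c : Fin 3 → ℝ)
    (hcomm : ∀ x : Fin 3 → ℝ,
      c + f.mulVec (![1, 0, 0] + (!![1,0,1; 0,1,0; 0,0,1] : Matrix (Fin 3) (Fin 3) ℝ).mulVec x)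
        = ![1, 0, 0] + (!![1,0,1; 0,1,0; 0,0,1] : Matrix (Fin 3) (Fin 3) ℝ).mulVec (c + f.mulVec x)) :
    c 2 = f 0 0 - 1 ∧ ∀ x : Fin 3 → ℝ, x 2 = -1 → (c + f.mulVec x) 2 = -1 := by
  have key : ∀ x : Fin 3 → ℝ, (1 + x 2) * f 0 0 = 1 + (c + f.mulVec x) 2 := by
    intro x
    have h := congrFun (hcomm x) 0
    simp [Matrix.mulVec, dotProduct, Fin.sum_univ_three] at h ⊢
    linarith
  refine ⟨?_, fun x hx => ?_⟩
  · have h := key 0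
    simp at h
    linarith
  · have h := key x
    rw [hx] at h
    linarith
end

section
/- Let g be the 3×3 real block-diagonal matrix with (1,1)-entry equal to 1, lower-right 2×2 block A, and all other entries of the first row and first column equal to 0, where A is a 2×2 real matrix with det A = 1 such that 1 is not an eigenvalue of A (det(A − I) ≠ 0). Let f be a 3×3 real matrix with det f = 1 such that f·g = g·f, and suppose there exists c ∈ ℝ³ with c − g(c) + f(e₁) − e₁ = 0. Then f·e₁ = e₁. -/
open Matrix

/-- Let `g = diag(1, A)` with `A ∈ SL(2,ℝ)` not having `1` as an eigenvalue.  If `f` is a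
`3×3` matrix of determinant `1` commuting with `g` and there is `c ∈ ℝ³` with
`c - g c + f e₁ - e₁ = 0`, then `f e₁ = e₁`. -/
theorem stmt_13 (A : Matrix (Fin 2) (Fin 2) ℝ) (hA1 : A.det = 1) (hA : (A - 1).det ≠ 0)
    (f : Matrix (Fin 3) (Fin 3) ℝ) (hdet : f.det = 1)
    (hcomm : f * !![1, 0, 0; 0, A 0 0, A 0 1; 0, A 1 0, A 1 1]
           = !![1, 0, 0; 0, A 0 0, A 0 1; 0, A 1 0, A 1 1] * f)
    (hc : ∃ c : Fin 3 → ℝ,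
      c - (!![1, 0, 0; 0, A 0 0, A 0 1; 0, A 1 0, A 1 1] : Matrix (Fin 3) (Fin 3) ℝ).mulVec c
        + f.mulVec ![1, 0, 0] - ![1, 0, 0] = 0) :
    f.mulVec ![1, 0, 0] = ![1, 0, 0] := by
  obtain ⟨c, hc⟩ := hc
  have h₀ : f 0 0 = 1 := by
    have h := congrFun hc 0
    simp [Matrix.vecHead, Matrix.mulVec, dotProduct, Fin.sum_univ_three] at h
    linarith
  have h₁ : f 1 0 = A 0 0 * f 1 0 + A 0 1 * f 2 0 := by
    simpa [Matrix.mul_apply, Fin.sum_univ_three] using congrFun (congrFun hcomm 1) 0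
  have h₂ : f 2 0 = A 1 0 * f 1 0 + A 1 1 * f 2 0 := by
    simpa [Matrix.mul_apply, Fin.sum_univ_three] using congrFun (congrFun hcomm 2) 0
  have hker : ![f 1 0, f 2 0] = 0 := by
    refine Matrix.eq_zero_of_mulVec_eq_zero hA ?_
    ext i
    fin_cases i <;> simp [Matrix.mulVec, dotProduct, Fin.sum_univ_two] <;> linarith
  have h₃ : f 1 0 = 0 := congrFun hker 0
  have h₄ : f 2 0 = 0 := congrFun hker 1
  ext i
  fin_cases i <;> simp [Matrix.mulVec, dotProduct, Fin.sum_univ_three, h₀, h₃, h₄]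
end

section
/- Let g₁ be the 3×3 real matrix with rows (1,0,0), (0,1,1), (0,0,1). Let f be a 3×3 real matrix with det f = 1 such that f·g₁ = g₁·f, and suppose there exists c ∈ ℝ³ with c − g₁(c) + f(e₁) − e₁ = 0. Then f₁₁ = 1, f₂₂ ∈ {1, −1}, and f·e₂ = f₂₂·e₂; in particular the line ℝe₂ is invariant under f. -/
open Matrix

/-- Let `g₁ = !![1,0,0; 0,1,1; 0,0,1]`.  If `f` is a `3×3` matrix of determinant `1`
commuting with `g₁` and there is `c ∈ ℝ³` with `c - g₁ c + f e₁ - e₁ = 0`, then `f₁₁ = 1`,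
`f₂₂ = ±1`, and `f e₂ = f₂₂ e₂`; in particular the line `ℝ e₂` is invariant under `f`. -/
theorem stmt_14 (f : Matrix (Fin 3) (Fin 3) ℝ) (hdet : f.det = 1)
    (hcomm : f * !![1,0,0; 0,1,1; 0,0,1] = !![1,0,0; 0,1,1; 0,0,1] * f)
    (hc : ∃ c : Fin 3 → ℝ,
      c - (!![1,0,0; 0,1,1; 0,0,1] : Matrix (Fin 3) (Fin 3) ℝ).mulVec c
        + f.mulVec ![1, 0, 0] - ![1, 0, 0] = 0) :
    f 0 0 = 1 ∧ (f 1 1 = 1 ∨ f 1 1 = -1) ∧ f.mulVec ![0, 1, 0] = f 1 1 • ![0, 1, 0] := by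
  obtain ⟨c, hc⟩ := hc
  have h00 : f 0 0 = 1 := by
    have h := congrFun hc 0
    simp [Matrix.mulVec, dotProduct, Fin.sum_univ_three, -Matrix.cons_mulVec] at h
    linarith
  have h01 : f 0 1 = 0 := by
    have h := congrFun (congrFun hcomm 0) 2
    simp [Matrix.mul_apply, Fin.sum_univ_three] at h
    linarith
  have h20 : f 2 0 = 0 := by
    have h := congrFun (congrFun hcomm 1) 0
    simp [Matrix.mul_apply, Fin.sum_univ_three] at h
    linarith
  have h21 : f 2 1 = 0 := by
    have h := congrFun (congrFun hcomm 1) 1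
    simp [Matrix.mul_apply, Fin.sum_univ_three] at h
    linarith
  have h22 : f 2 2 = f 1 1 := by
    have h := congrFun (congrFun hcomm 1) 2
    simp [Matrix.mul_apply, Fin.sum_univ_three] at h
    linarith
  refine ⟨h00, ?_, ?_⟩
  · rw [Matrix.det_fin_three, h00, h01, h20, h21, h22] at hdet
    exact mul_self_eq_one_iff.mp (by linarith)
  · ext i
    fin_cases i <;> simp [Matrix.mulVec, dotProduct, Fin.sum_univ_three, h01, h21]
end

section
/- Let g₂ be the 3×3 real matrix with rows (1,1,0), (0,1,1), (0,0,1), and let φ be the affine transformation of ℝ³ given by φ(x) = e₁ + g₂(x). Let γ(x) = c + f(x) be an affine transformation of ℝ³ with f a 3×3 real matrix of determinant 1, and suppose γ commutes with φ. Then f has rows (1, β, w), (0, 1, β), (0, 0, 1) for some real β, w, and c ∈ ℝe₁ (i.e., c₂ = c₃ = 0). In particular γ is a unipotent affine transformation. -/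
open Matrix

/-- Let `φ(x) = e₁ + g₂ x` with `g₂ = !![1,1,0; 0,1,1; 0,0,1]`, and let `γ(x) = c + f x`
be an affine transformation of `ℝ³` with `det f = 1` commuting with `φ`.  Then `f` has rows
`(1, β, w), (0, 1, β), (0, 0, 1)` for some reals `β, w` and `c ∈ ℝ e₁` (i.e. `c₂ = c₃ = 0`);
in particular `γ` is a unipotent affine transformation. -/
theorem stmt_15 (f : Matrix (Fin 3) (Fin 3) ℝ) (hdet : f.det = 1) (c : Fin 3 → ℝ)
    (hcomm : ∀ x : Fin 3 → ℝ,
      c + f.mulVec (![1, 0, 0] + (!![1,1,0; 0,1,1; 0,0,1] : Matrix (Fin 3) (Fin 3) ℝ).mulVec x)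
        = ![1, 0, 0] + (!![1,1,0; 0,1,1; 0,0,1] : Matrix (Fin 3) (Fin 3) ℝ).mulVec (c + f.mulVec x)) :
    (∃ β w : ℝ, f = !![1, β, w; 0, 1, β; 0, 0, 1]) ∧ c 1 = 0 ∧ c 2 = 0 ∧
      IsNilpotent (f - 1) := by
  have at_zero := hcomm 0
  have at_e₁ := hcomm ![1, 0, 0]
  have at_e₂ := hcomm ![0, 1, 0]
  have at_e₃ := hcomm ![0, 0, 1]
  simp only [funext_iff, Fin.forall_fin_succ, IsEmpty.forall_iff, and_true, Pi.add_apply,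
    mulVec, dotProduct, Fin.sum_univ_three] at at_zero at_e₁ at_e₂ at_e₃
  simp at at_zero at_e₁ at_e₂ at_e₃
  obtain ⟨z₀, z₁, z₂⟩ := at_zero
  obtain ⟨p₀, p₁, p₂⟩ := at_e₁
  obtain ⟨q₀, q₁, q₂⟩ := at_e₂
  obtain ⟨r₀, r₁, r₂⟩ := at_e₃
  have h10 : f 1 0 = 0 := by linarith
  have h20 : f 2 0 = 0 := by linarith
  have h21 : f 2 1 = 0 := by linarith
  have h11 : f 1 1 = f 0 0 := by linarith
  have h22 : f 2 2 = f 0 0 := by linarith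
  have h12 : f 1 2 = f 0 1 := by linarith
  have h00 : f 0 0 = 1 := by
    rw [det_fin_three, h10, h20, h21, h11, h22] at hdet
    have hcube : f 0 0 ^ 3 = 1 ^ 3 := by linear_combination hdet
    exact (Odd.strictMono_pow (by decide : Odd 3)).injective hcube
  have hf : f = !![1, f 0 1, f 0 2; 0, 1, f 0 1; 0, 0, 1] := by
    ext i j
    fin_cases i <;> fin_cases j <;> simp [h10, h20, h21, h11, h22, h12, h00]
  refine ⟨⟨f 0 1, f 0 2, hf⟩, by linarith, by linarith, 3, ?_⟩
  rw [hf]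
  ext i j
  fin_cases i <;> fin_cases j <;> simp [pow_succ, mul_apply, Fin.sum_univ_three]
end

section
/- Let g be a 3×3 real matrix that is unipotent (i.e., (g − I)³ = 0) with g ≠ I, and let b ∈ ℝ³ be a nonzero vector with g(b) = b. Then there exists P ∈ GL(3,ℝ) with P(b) = e₁ such that P·g·P⁻¹ is one of the three matrices: g₁ with rows (1,0,0), (0,1,1), (0,0,1); g₂ with rows (1,1,0), (0,1,1), (0,0,1); g₃ with rows (1,0,1), (0,1,0), (0,0,1). -/
open Matrix

/-- Three vectors of a module over a field are linearly independent as soon as every vanishing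
combination is trivial. -/
theorem linearIndependent_triple {K V : Type*} [Field K] [AddCommGroup V] [Module K V]
    {x y z : V}
    (h : ∀ r s t : K, r • x + s • y + t • z = 0 → r = 0 ∧ s = 0 ∧ t = 0) :
    LinearIndependent K ![x, y, z] := by
  rw [Fintype.linearIndependent_iff]
  intro c hc
  obtain ⟨h0, h1, h2⟩ := h (c 0) (c 1) (c 2) (by simpa [Fin.sum_univ_three] using hc)
  intro i
  fin_cases i <;> assumption

/-- If the linearly independent columns of a matrix `Q` intertwine `g` and `G`, then `Q⁻¹`
conjugates `g` to `G` and sends the first column to the first standard basis vector. -/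
theorem exists_conj_of_linearIndependent {K : Type*} [Field K] {g G : Matrix (Fin 3) (Fin 3) K}
    {x y z : Fin 3 → K} (hli : LinearIndependent K ![x, y, z])
    (hG : g * (of ![x, y, z])ᵀ = (of ![x, y, z])ᵀ * G) :
    ∃ P : Matrix (Fin 3) (Fin 3) K, IsUnit P ∧ P *ᵥ x = ![1, 0, 0] ∧ P * g * P⁻¹ = G := by
  set Q : Matrix (Fin 3) (Fin 3) K := (of ![x, y, z])ᵀ with hQdef
  have hQ : IsUnit Q := linearIndependent_cols_iff_isUnit.1 hli
  have hdet : IsUnit Q.det := (isUnit_iff_isUnit_det Q).1 hQ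
  have hx : Q *ᵥ ![1, 0, 0] = x := by
    ext i
    simp [hQdef, mulVec, dotProduct, Fin.sum_univ_three]
  refine ⟨Q⁻¹, (isUnit_nonsing_inv_iff).2 hQ, ?_, ?_⟩
  · rw [← hx, mulVec_mulVec, nonsing_inv_mul Q hdet, one_mulVec]
  · rw [nonsing_inv_nonsing_inv Q hdet, mul_assoc, hG, ← mul_assoc, nonsing_inv_mul Q hdet,
      one_mul]

/-- A nonzero matrix has a vector outside its kernel. -/
theorem exists_mulVec_ne_zero {K : Type*} [Field K] {N : Matrix (Fin 3) (Fin 3) K}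
    (hN : N ≠ 0) : ∃ v, N *ᵥ v ≠ 0 := by
  by_contra! h
  exact hN (ext_of_mulVec_single fun i => by rw [h, zero_mulVec])

/-- A square-zero `3 × 3` matrix has a kernel vector outside any given line. -/
theorem exists_ker_notMem_span {K : Type*} [Field K] {N : Matrix (Fin 3) (Fin 3) K}
    (hN : N * N = 0) (b : Fin 3 → K) : ∃ u, N *ᵥ u = 0 ∧ u ∉ Submodule.span K {b} := by
  by_contra! h
  have hker : LinearMap.ker N.mulVecLin ≤ Submodule.span K {b} := fun u hu =>
    h u (by simpa using hu)
  have hrange : LinearMap.range N.mulVecLin ≤ LinearMap.ker N.mulVecLin := by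
    rintro _ ⟨v, rfl⟩
    simp [mulVec_mulVec, hN]
  have h1 := (Submodule.finrank_mono hker).trans (finrank_span_le_card {b})
  have h2 := Submodule.finrank_mono hrange
  have h3 := LinearMap.finrank_range_add_finrank_ker N.mulVecLin
  simp only [Set.toFinset_singleton, Finset.card_singleton] at h1
  simp only [Module.finrank_fin_fun] at h3
  omega

/-- A vector `v` with `N² v ≠ 0` generates a Jordan chain of length three. -/
theorem linearIndependent_jordan_chain {K : Type*} [Field K] {N : Matrix (Fin 3) (Fin 3) K}
    (hN : N ^ 3 = 0) {v : Fin 3 → K} (hv : N *ᵥ N *ᵥ v ≠ 0) :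
    LinearIndependent K ![N *ᵥ N *ᵥ v, N *ᵥ v, v] := by
  have h3 : N *ᵥ N *ᵥ N *ᵥ v = 0 := by
    rw [mulVec_mulVec, mulVec_mulVec, ← pow_three', hN, zero_mulVec]
  refine linearIndependent_triple fun r s t h => ?_
  have ht : t = 0 := by
    have := congrArg (fun x => N *ᵥ N *ᵥ x) h
    simpa [-mulVec_mulVec, mulVec_add, mulVec_smul, h3, hv] using this
  subst ht
  have hs : s = 0 := by
    have := congrArg (fun x => N *ᵥ x) h
    simpa [-mulVec_mulVec, mulVec_add, mulVec_smul, h3, hv] using this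
  subst hs
  exact ⟨by simpa [-mulVec_mulVec, hv] using h, rfl, rfl⟩

/-- Let `g` be a unipotent `3×3` real matrix with `g ≠ I`, and let `b ≠ 0` be a fixed
vector of `g`.  Then there is `P ∈ GL(3,ℝ)` with `P b = e₁` conjugating `g` to one of the
three model matrices `g₁ = !![1,0,0; 0,1,1; 0,0,1]`, `g₂ = !![1,1,0; 0,1,1; 0,0,1]`,
`g₃ = !![1,0,1; 0,1,0; 0,0,1]`. -/
theorem stmt_16 (g : Matrix (Fin 3) (Fin 3) ℝ) (hg : (g - 1) ^ 3 = 0) (hne : g ≠ 1)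
    (b : Fin 3 → ℝ) (hb0 : b ≠ 0) (hgb : g.mulVec b = b) :
    ∃ P : Matrix (Fin 3) (Fin 3) ℝ, IsUnit P ∧ P.mulVec b = ![1, 0, 0] ∧
      (P * g * P⁻¹ = !![1,0,0; 0,1,1; 0,0,1] ∨
       P * g * P⁻¹ = !![1,1,0; 0,1,1; 0,0,1] ∨
       P * g * P⁻¹ = !![1,0,1; 0,1,0; 0,0,1]) := by
  obtain ⟨N, rfl⟩ : ∃ N, g = 1 + N := ⟨g - 1, by abel⟩
  rw [add_sub_cancel_left] at hg
  have hN : N ≠ 0 := by simpa using hne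
  have hb : N *ᵥ b = 0 := by simpa [add_mulVec] using hgb
  have hcol : ∀ x i, N i 0 * x 0 + N i 1 * x 1 + N i 2 * x 2 = (N *ᵥ x) i := fun x i => by
    simp [mulVec, dotProduct, Fin.sum_univ_three]
  by_cases hsq : N * N = 0
  · obtain ⟨v, hv⟩ := exists_mulVec_ne_zero hN
    have hNNv : N *ᵥ N *ᵥ v = 0 := by rw [mulVec_mulVec, hsq, zero_mulVec]
    by_cases hbv : ∃ c : ℝ, c • (N *ᵥ v) = b
    · obtain ⟨c, hc⟩ := hbv
      obtain ⟨u, hu, hub⟩ := exists_ker_notMem_span hsq b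
      have hw : N *ᵥ (c • v) = b := by rw [mulVec_smul, hc]
      generalize c • v = w at hw
      have hli : LinearIndependent ℝ ![b, u, w] := by
        refine linearIndependent_triple fun r s t h => ?_
        have ht : t = 0 := by
          have := congrArg (fun x => N *ᵥ x) h
          simpa [-mulVec_mulVec, mulVec_add, mulVec_smul, hb, hu, hw, hb0] using this
        subst ht
        have hs : s = 0 := by
          by_contra hs
          refine hub (Submodule.mem_span_singleton.2 ⟨-(s⁻¹ * r), ?_⟩)
          have : s • u = -(r • b) := by
            rw [zero_smul, add_zero] at h
            exact eq_neg_of_add_eq_zero_right h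
          rw [← inv_smul_smul₀ hs u, this, smul_neg, smul_smul, neg_smul]
        subst hs
        exact ⟨by simpa [hb0] using h, rfl, rfl⟩
      obtain ⟨P, hP, hPb, hPg⟩ := exists_conj_of_linearIndependent (g := 1 + N)
        (G := !![1,0,1; 0,1,0; 0,0,1]) hli (by
          rw [add_mul, one_mul]
          ext i j
          fin_cases j <;> simp [mul_apply, Fin.sum_univ_three, hcol, hb, hu, hw, add_comm])
      exact ⟨P, hP, hPb, .inr (.inr hPg)⟩
    · have hli : LinearIndependent ℝ ![b, N *ᵥ v, v] := by
        refine linearIndependent_triple fun r s t h => ?_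
        have ht : t = 0 := by
          have := congrArg (fun x => N *ᵥ x) h
          simpa [-mulVec_mulVec, mulVec_add, mulVec_smul, hb, hNNv, hv] using this
        subst ht
        have hr : r = 0 := by
          by_contra hr
          refine hbv ⟨-(r⁻¹ * s), ?_⟩
          have : r • b = -(s • (N *ᵥ v)) := by
            rw [zero_smul, add_zero] at h
            exact eq_neg_of_add_eq_zero_left h
          rw [← inv_smul_smul₀ hr b, this, smul_neg, smul_smul, neg_smul]
        subst hr
        exact ⟨rfl, by simpa [hv] using h, rfl⟩
      obtain ⟨P, hP, hPb, hPg⟩ := exists_conj_of_linearIndependent (g := 1 + N)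
        (G := !![1,0,0; 0,1,1; 0,0,1]) hli (by
          rw [add_mul, one_mul]
          ext i j
          fin_cases j <;> simp [mul_apply, Fin.sum_univ_three, hcol, hb, hNNv, add_comm])
      exact ⟨P, hP, hPb, .inl hPg⟩
  · obtain ⟨v, hv⟩ := exists_mulVec_ne_zero hsq
    rw [← mulVec_mulVec] at hv
    have hN3 : N *ᵥ N *ᵥ N *ᵥ v = 0 := by
      rw [mulVec_mulVec, mulVec_mulVec, ← pow_three', hg, zero_mulVec]
    obtain ⟨c, hc⟩ : ∃ c : Fin 3 → ℝ, ∑ i, c i • ![N *ᵥ N *ᵥ v, N *ᵥ v, v] i = b := by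
      rw [← Submodule.mem_span_range_iff_exists_fun,
        (linearIndependent_jordan_chain hg hv).span_eq_top_of_card_eq_finrank' (by simp)]
      trivial
    simp only [Fin.sum_univ_three, cons_val] at hc
    have h2 : c 2 = 0 := by
      have := congrArg (fun x => N *ᵥ N *ᵥ x) hc
      simpa [-mulVec_mulVec, mulVec_add, mulVec_smul, hN3, hb, hv] using this
    have h1 : c 1 = 0 := by
      have := congrArg (fun x => N *ᵥ x) hc
      simpa [-mulVec_mulVec, mulVec_add, mulVec_smul, hN3, hb, hv, h2] using this
    have hw : N *ᵥ N *ᵥ (c 0 • v) = b := by simpa [-mulVec_mulVec, mulVec_smul, h1, h2] using hc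
    generalize c 0 • v = w at hw
    have hli := linearIndependent_jordan_chain hg (v := w) (by rwa [hw])
    rw [hw] at hli
    obtain ⟨P, hP, hPb, hPg⟩ := exists_conj_of_linearIndependent (g := 1 + N)
      (G := !![1,1,0; 0,1,1; 0,0,1]) hli (by
        rw [add_mul, one_mul]
        ext i j
        fin_cases j <;> simp [mul_apply, Fin.sum_univ_three, hcol, hb, hw, add_comm])
    exact ⟨P, hP, hPb, .inr (.inl hPg)⟩
end
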